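/- Let C = (C_1,…,C_d) be a row contraction on a Hilbert space H_C, A = (A_1,…,A_d) a row contraction on a Hilbert space H_A, and δ : 𝒟_{*,A} → 𝒟_C a contraction. Define B := D_{*,A} ∘ δ* ∘ D_C : H_C^d → H_A, and let E be the tuple on H_C ⊕ H_A with block matrices E_i = [[C_i, 0],[B_i, A_i]], where B_i := B ∘ ι_i with ι_i : H_C → H_C^d the i-th coordinate inclusion. Then there exists a unitary operator σ_E : 𝒟_E → 𝒟_{*,δ} ⊕ 𝒟_A such that for every h_C ⊕ h_A ∈ H_C^d ⊕ H_A^d ≅ (H_C ⊕ H_A)^d, σ_E (D_E (h_C ⊕ h_A)) = (D_{*,δ} D_C h_C) ⊕ (D_A h_A − 𝐀* δ* D_C h_C), where 𝐀* : H_A → H_A^d is the adjoint of the row operator of A. -/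

import Mathlib

noncomputable section

/-- The Hilbert space `ℓ²`-direct sum of `d` copies of `H`. -/
abbrev Hd (d : ℕ) (H : Type*) : Type _ := PiLp 2 fun _ : Fin d => H

/-- The row operator `𝐀 : H^d → K`, `(h_1, …, h_d) ↦ Σ_i A_i h_i`, of a `d`-tuple of
bounded operators `A_i : H → K`. -/
noncomputable def rowOp {d : ℕ} {H K : Type*} [NormedAddCommGroup H] [InnerProductSpace ℂ H]
    [NormedAddCommGroup K] [InnerProductSpace ℂ K] (A : Fin d → (H →L[ℂ] K)) :
    Hd d H →L[ℂ] K :=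
  ∑ i, (A i).comp ((ContinuousLinearMap.proj i).comp
    (PiLp.continuousLinearEquiv 2 ℂ fun _ : Fin d => H).toContinuousLinearMap)

/-- The `i`-th coordinate inclusion `ι_i : H → H^d`. -/
noncomputable def inclPi {d : ℕ} {H : Type*} [NormedAddCommGroup H] [InnerProductSpace ℂ H]
    (i : Fin d) : H →L[ℂ] Hd d H :=
  ((PiLp.continuousLinearEquiv 2 ℂ fun _ : Fin d => H).symm.toContinuousLinearMap).comp
    (ContinuousLinearMap.pi fun j => if j = i then ContinuousLinearMap.id ℂ H else 0)

/-- First coordinate projection of the Hilbert direct sum `H ⊕ K`. -/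
noncomputable def prodFst {H K : Type*} [NormedAddCommGroup H] [InnerProductSpace ℂ H]
    [NormedAddCommGroup K] [InnerProductSpace ℂ K] : WithLp 2 (H × K) →L[ℂ] H :=
  (ContinuousLinearMap.fst ℂ H K).comp (WithLp.prodContinuousLinearEquiv 2 ℂ H K).toContinuousLinearMap

/-- Second coordinate projection of the Hilbert direct sum `H ⊕ K`. -/
noncomputable def prodSnd {H K : Type*} [NormedAddCommGroup H] [InnerProductSpace ℂ H]
    [NormedAddCommGroup K] [InnerProductSpace ℂ K] : WithLp 2 (H × K) →L[ℂ] K :=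
  (ContinuousLinearMap.snd ℂ H K).comp (WithLp.prodContinuousLinearEquiv 2 ℂ H K).toContinuousLinearMap

/-- The `2 × 2` block operator `[[T₁₁, T₁₂], [T₂₁, T₂₂]] : H ⊕ K → H' ⊕ K'`. -/
noncomputable def block2 {H K H' K' : Type*}
    [NormedAddCommGroup H] [InnerProductSpace ℂ H] [NormedAddCommGroup K] [InnerProductSpace ℂ K]
    [NormedAddCommGroup H'] [InnerProductSpace ℂ H'] [NormedAddCommGroup K'] [InnerProductSpace ℂ K']
    (T11 : H →L[ℂ] H') (T12 : K →L[ℂ] H') (T21 : H →L[ℂ] K') (T22 : K →L[ℂ] K') :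
    WithLp 2 (H × K) →L[ℂ] WithLp 2 (H' × K') :=
  ((WithLp.prodContinuousLinearEquiv 2 ℂ H' K').symm.toContinuousLinearMap).comp
    ((T11.comp prodFst + T12.comp prodSnd).prod (T21.comp prodFst + T22.comp prodSnd))

/-- The defect space of a defect operator `D : H → K`: the closure of its range. -/
abbrev defectSpace {H K : Type*} [NormedAddCommGroup H] [InnerProductSpace ℂ H]
    [NormedAddCommGroup K] [InnerProductSpace ℂ K] (D : H →L[ℂ] K) : Submodule ℂ K :=
  (LinearMap.range (D : H →ₗ[ℂ] K)).topologicalClosure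

/-- A defect operator `D : H → K`, viewed as a map into its defect space. -/
noncomputable def toDefect {H K : Type*} [NormedAddCommGroup H] [InnerProductSpace ℂ H]
    [NormedAddCommGroup K] [InnerProductSpace ℂ K] (D : H →L[ℂ] K) : H →L[ℂ] ↥(defectSpace D) :=
  D.codRestrict _ fun x => Submodule.le_topologicalClosure _ (LinearMap.mem_range_self (D : H →ₗ[ℂ] K) x)

/-- The canonical identification `(H ⊕ K)^d ≅ H^d ⊕ K^d`:  from a pair
`(h, k) ∈ H^d ⊕ K^d` form the element of `(H ⊕ K)^d` with `i`-th entry `(h_i, k_i)`. -/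
noncomputable def pairup {d : ℕ} {H K : Type*} [NormedAddCommGroup H] [InnerProductSpace ℂ H]
    [NormedAddCommGroup K] [InnerProductSpace ℂ K] (h : Hd d H) (k : Hd d K) :
    Hd d (WithLp 2 (H × K)) :=
  (WithLp.equiv 2 _).symm fun i =>
    (WithLp.equiv 2 (H × K)).symm ((WithLp.equiv 2 _) h i, (WithLp.equiv 2 _) k i)


/-- A finite `ℓ²`-direct sum of complete spaces is complete. -/
instance PiLp.instCompleteSpaceOfFintype (p : ENNReal) [Fact (1 ≤ p)] {ι : Type*} [Fintype ι]
    (β : ι → Type*) [∀ i, NormedAddCommGroup (β i)] [∀ i, CompleteSpace (β i)] :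
    CompleteSpace (PiLp p β) := by
  have e : PiLp p β ≃ᵤ (∀ i, β i) :=
    { toEquiv := WithLp.equiv p _
      uniformContinuous_toFun := (PiLp.lipschitzWith_ofLp p β).uniformContinuous
      uniformContinuous_invFun := ((PiLp.antilipschitzWith_ofLp p β).to_rightInverse
        (fun _ => rfl)).uniformContinuous }
  exact e.completeSpace_iff.mpr inferInstance



section helpers
open ContinuousLinearMap

theorem aux_intertwine {H K : Type*} [NormedAddCommGroup H] [InnerProductSpace ℂ H]
    [CompleteSpace H] [NormedAddCommGroup K] [InnerProductSpace ℂ K] [CompleteSpace K]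
    (P : K →L[ℂ] K) (Q : H →L[ℂ] H) (T : H →L[ℂ] K) (hP : P.IsPositive) (hQ : Q.IsPositive)
    (h : ∀ x, P (P (T x)) = T (Q (Q x))) (x : H) : P (T x) = T (Q x) := by
  set X : H →L[ℂ] K := P.comp T - T.comp Q with hX
  have hXv : ∀ v, X v = P (T v) - T (Q v) := fun v => rfl
  have hPX : ∀ v, P (X v) = - X (Q v) := by
    intro v
    simp only [hXv, map_sub, h]
    abel
  have hPs : adjoint P = P := hP.isSelfAdjoint
  have hQs : adjoint Q = Q := hQ.isSelfAdjoint
  set N : H →L[ℂ] H := (adjoint X).comp X with hN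
  have hNpos : N.IsPositive := by
    exact isPositive_adjoint_comp_self X
  set M : H →L[ℂ] H := (adjoint X).comp (P.comp X) with hM
  have hMpos : M.IsPositive := hP.adjoint_conj X
  have hMN : M = - (N * Q) := by
    ext v
    simp [hM, hN, hPX]
  have hNQ : adjoint (N * Q) = N * Q := by
    have : N * Q = - M := by rw [hMN]; simp
    rw [this, map_neg]
    congr 1
    exact hMpos.isSelfAdjoint
  have hcomm : Commute N Q := by
    have h1 : adjoint (N * Q) = Q * N := by
      change star (N * Q) = _
      rw [star_mul]
      change adjoint Q * adjoint N = _
      rw [hQs]; congr 1; exact hNpos.isSelfAdjoint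
    exact hNQ.symm.trans h1
  have hpos : 0 ≤ N * Q :=
    Commute.mul_nonneg ((nonneg_iff_isPositive N).2 hNpos) ((nonneg_iff_isPositive Q).2 hQ) hcomm
  have hneg : N * Q ≤ 0 := by
    have := (nonneg_iff_isPositive M).2 hMpos
    rw [hMN] at this
    exact neg_nonneg.1 this
  have hz : N * Q = 0 := le_antisymm hneg hpos
  have hXQ : ∀ v, X (Q v) = 0 := by
    intro v
    have h1 : adjoint X (X (Q v)) = 0 := DFunLike.congr_fun hz v
    have h2 : inner ℂ (X (Q v)) (X (Q v)) = 0 := by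
      rw [← adjoint_inner_left, h1, inner_zero_left]
    exact inner_self_eq_zero.1 h2
  have hQX : ∀ v, Q (adjoint X v) = 0 := by
    intro v
    have : X.comp Q = 0 := by ext w; exact hXQ w
    have h2 := congrArg adjoint this
    rw [adjoint_comp, hQs, map_zero] at h2
    exact DFunLike.congr_fun h2 v
  have hXX : ∀ v, inner ℂ (X v) (X v) = 0 := by
    have hXXX : ∀ w, X (adjoint X w) = P (T (adjoint X w)) := by
      intro w
      rw [hXv, hQX, map_zero, sub_zero]
    intro v
    -- N v = X* X v,  ‖N v‖² = ⟪X X* X v, X v⟫ = ⟪T X* X v, P X v⟫ = 0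
    have h1 : inner ℂ (adjoint X (X v)) (adjoint X (X v)) = 0 := by
      rw [adjoint_inner_right, hXXX, ← adjoint_inner_right, hPs, hPX, hXQ, neg_zero,
        inner_zero_right]
    have h2 := inner_self_eq_zero.1 h1
    rw [← adjoint_inner_left, h2, inner_zero_left]
  have := inner_self_eq_zero.1 (hXX x)
  rw [hXv] at this
  exact sub_eq_zero.1 this

theorem aux_mem_defect {H : Type*} [NormedAddCommGroup H] [InnerProductSpace ℂ H]
    [CompleteSpace H] (D : H →L[ℂ] H) (hD : D.IsPositive) (y : H)
    (h : ∀ x, D x = 0 → inner ℂ x y = 0) : y ∈ defectSpace D := by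
  have hs : adjoint D = D := hD.isSelfAdjoint
  unfold defectSpace
  rw [← Submodule.orthogonal_orthogonal_eq_closure, Submodule.mem_orthogonal]
  intro x hx
  apply h
  have := D.orthogonal_range ▸ hx
  rw [hs] at this
  exact this

theorem aux_defect_inner {H : Type*} [NormedAddCommGroup H] [InnerProductSpace ℂ H]
    [CompleteSpace H] (D : H →L[ℂ] H) (hD : D.IsPositive) (y : H) (hy : y ∈ defectSpace D)
    (x : H) (hx : D x = 0) : inner ℂ x y = 0 := by
  have hs : adjoint D = D := hD.isSelfAdjoint
  unfold defectSpace at hy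
  rw [← Submodule.orthogonal_orthogonal_eq_closure, Submodule.mem_orthogonal] at hy
  apply hy
  have := D.orthogonal_range
  rw [hs] at this
  exact this ▸ hx

theorem aux_denseRange_toDefect {H K : Type*} [NormedAddCommGroup H] [InnerProductSpace ℂ H]
    [NormedAddCommGroup K] [InnerProductSpace ℂ K] (D : H →L[ℂ] K) :
    DenseRange (toDefect D) := by
  rintro ⟨y, hy⟩
  rw [closure_subtype]
  have : ((↑) : ↥(defectSpace D) → K) '' Set.range (toDefect D) = Set.range D := by
    rw [← Set.range_comp]; rfl
  rw [this]
  exact hy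

theorem aux_inner_defect {H K : Type*} [NormedAddCommGroup H] [InnerProductSpace ℂ H]
    [CompleteSpace H] [NormedAddCommGroup K] [InnerProductSpace ℂ K] [CompleteSpace K]
    (D : H →L[ℂ] H) (hD : D.IsPositive) (T : H →L[ℂ] K)
    (hsq : D.comp D = 1 - (adjoint T).comp T) (x : H) :
    ‖D x‖ ^ 2 = ‖x‖ ^ 2 - ‖T x‖ ^ 2 := by
  have hs : adjoint D = D := hD.isSelfAdjoint
  have h1 : inner ℂ (D x) (D x) = inner ℂ x x - inner ℂ (T x) (T x) := by
    rw [← adjoint_inner_left, hs]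
    have : D (D x) = x - adjoint T (T x) := DFunLike.congr_fun hsq x
    rw [this, inner_sub_left, adjoint_inner_left]
  simp only [inner_self_eq_norm_sq_to_K] at h1
  exact_mod_cast h1

theorem aux_mem_A {H K : Type*} [NormedAddCommGroup H] [InnerProductSpace ℂ H]
    [CompleteSpace H] [NormedAddCommGroup K] [InnerProductSpace ℂ K] [CompleteSpace K]
    (T : H →L[ℂ] K) (P : K →L[ℂ] K) (Q : H →L[ℂ] H) (hP : P.IsPositive) (hQ : Q.IsPositive)
    (h : ∀ x, P (T x) = T (Q x)) (y : K) (hy : y ∈ defectSpace P) :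
    adjoint T y ∈ defectSpace Q := by
  apply aux_mem_defect Q hQ
  intro x hx
  rw [adjoint_inner_right]
  apply aux_defect_inner P hP y hy
  rw [h, hx, map_zero]

theorem aux_rowOp_apply {d : ℕ} {H K : Type*} [NormedAddCommGroup H] [InnerProductSpace ℂ H]
    [NormedAddCommGroup K] [InnerProductSpace ℂ K] (A : Fin d → (H →L[ℂ] K)) (h : Hd d H) :
    rowOp A h = ∑ i, A i (h i) := by
  simp [rowOp]

theorem aux_sum_incl {d : ℕ} {H : Type*} [NormedAddCommGroup H] [InnerProductSpace ℂ H]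
    (h : Hd d H) : ∑ i, inclPi i (h i) = h := by
  ext j
  have : ∀ i, (inclPi i (h i) : Hd d H) j = if j = i then h i else 0 := by
    intro i
    by_cases hji : j = i <;> simp [inclPi, hji]
  simp [this]

theorem aux_rowOp_pairup {d : ℕ} {H K : Type*} [NormedAddCommGroup H] [InnerProductSpace ℂ H]
    [NormedAddCommGroup K] [InnerProductSpace ℂ K] (C : Fin d → (H →L[ℂ] H))
    (A : Fin d → (K →L[ℂ] K)) (B : Hd d H →L[ℂ] K)
    (E : Fin d → (WithLp 2 (H × K) →L[ℂ] WithLp 2 (H × K)))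
    (hE : ∀ i, E i = block2 (C i) 0 (B.comp (inclPi i)) (A i)) (h : Hd d H) (k : Hd d K) :
    rowOp E (pairup h k) = WithLp.toLp 2 (rowOp C h, B h + rowOp A k) := by
  have hB : B h = ∑ i, B (inclPi i (h i)) := by rw [← map_sum, aux_sum_incl]
  have hi : ∀ i, E i (pairup h k i) =
      WithLp.toLp 2 (C i (h i), B (inclPi i (h i)) + A i (k i)) := by
    intro i
    rw [hE]
    simp [block2, pairup, prodFst, prodSnd]
  rw [aux_rowOp_apply, aux_rowOp_apply, aux_rowOp_apply, hB, ← Finset.sum_add_distrib]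
  simp only [hi]
  rw [← WithLp.toLp_sum]
  congr 1
  rw [Prod.ext_iff]
  simp [Prod.fst_sum, Prod.snd_sum]

theorem aux_norm_pairup {d : ℕ} {H K : Type*} [NormedAddCommGroup H] [InnerProductSpace ℂ H]
    [NormedAddCommGroup K] [InnerProductSpace ℂ K] (h : Hd d H) (k : Hd d K) :
    ‖pairup h k‖ ^ 2 = ‖h‖ ^ 2 + ‖k‖ ^ 2 := by
  simp only [PiLp.norm_sq_eq_of_L2, ← Finset.sum_add_distrib]
  refine Finset.sum_congr rfl fun i _ => ?_
  rw [WithLp.prod_norm_sq_eq_of_L2]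
  rfl

/-- `pairup` as a linear map. -/
def auxPair {d : ℕ} {H K : Type*} [NormedAddCommGroup H] [InnerProductSpace ℂ H]
    [NormedAddCommGroup K] [InnerProductSpace ℂ K] :
    (Hd d H × Hd d K) →ₗ[ℂ] Hd d (WithLp 2 (H × K)) where
  toFun p := pairup p.1 p.2
  map_add' _ _ := rfl
  map_smul' _ _ := rfl

theorem auxPair_surj {d : ℕ} {H K : Type*} [NormedAddCommGroup H] [InnerProductSpace ℂ H]
    [NormedAddCommGroup K] [InnerProductSpace ℂ K] :
    Function.Surjective (auxPair (d := d) (H := H) (K := K)) := fun x =>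
  ⟨(WithLp.toLp 2 fun i => (x i).fst, WithLp.toLp 2 fun i => (x i).snd), rfl⟩

end helpers

set_option maxHeartbeats 2000000 in
open ContinuousLinearMap in
/-- There is a unitary `σ_E : 𝒟_E → 𝒟_{*,δ} ⊕ 𝒟_A` with
`σ_E (D_E (h_C ⊕ h_A)) = (D_{*,δ} D_C h_C) ⊕ (D_A h_A − 𝐀* δ* D_C h_C)`. -/
theorem statement1 {d : ℕ} {H_C H_A : Type*}
    [NormedAddCommGroup H_C] [InnerProductSpace ℂ H_C] [CompleteSpace H_C]
    [NormedAddCommGroup H_A] [InnerProductSpace ℂ H_A] [CompleteSpace H_A]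
    (C : Fin d → (H_C →L[ℂ] H_C)) (A : Fin d → (H_A →L[ℂ] H_A))
    (hC : ‖rowOp C‖ ≤ 1) (hA : ‖rowOp A‖ ≤ 1)
    -- the defect operator `D_C` of `C`
    (DC : Hd d H_C →L[ℂ] Hd d H_C) (hDCpos : DC.IsPositive)
    (hDCsq : DC.comp DC = 1 - (adjoint (rowOp C)).comp (rowOp C))
    -- the defect operator `D_{*,A}` of `A`
    (DsA : H_A →L[ℂ] H_A) (hDsApos : DsA.IsPositive)
    (hDsAsq : DsA.comp DsA = 1 - (rowOp A).comp (adjoint (rowOp A)))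
    -- the defect operator `D_A` of `A`
    (DA : Hd d H_A →L[ℂ] Hd d H_A) (hDApos : DA.IsPositive)
    (hDAsq : DA.comp DA = 1 - (adjoint (rowOp A)).comp (rowOp A))
    -- the contraction `δ : 𝒟_{*,A} → 𝒟_C`
    (δ : ↥(defectSpace DsA) →L[ℂ] ↥(defectSpace DC)) (hδ : ‖δ‖ ≤ 1)
    -- the defect operator `D_{*,δ}` of `δ`
    (Dsδ : ↥(defectSpace DC) →L[ℂ] ↥(defectSpace DC)) (hDsδpos : Dsδ.IsPositive)
    (hDsδsq : Dsδ.comp Dsδ = 1 - δ.comp (adjoint δ))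
    -- `B := D_{*,A} ∘ δ* ∘ D_C : H_C^d → H_A`
    (B : Hd d H_C →L[ℂ] H_A)
    (hB : B = DsA.comp (((defectSpace DsA).subtypeL).comp ((adjoint δ).comp (toDefect DC))))
    -- the lifting `E`, `E_i = [[C_i, 0], [B ∘ ι_i, A_i]]`
    (E : Fin d → (WithLp 2 (H_C × H_A) →L[ℂ] WithLp 2 (H_C × H_A)))
    (hE : ∀ i, E i = block2 (C i) 0 (B.comp (inclPi i)) (A i))
    -- the defect operator `D_E` of `E`
    (DE : Hd d (WithLp 2 (H_C × H_A)) →L[ℂ] Hd d (WithLp 2 (H_C × H_A))) (hDEpos : DE.IsPositive)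
    (hDEsq : DE.comp DE = 1 - (adjoint (rowOp E)).comp (rowOp E)) :
    ∃ σE : ↥(defectSpace DE) ≃ₗᵢ[ℂ] WithLp 2 (↥(defectSpace Dsδ) × ↥(defectSpace DA)),
      ∀ (hc : Hd d H_C) (ha : Hd d H_A),
        ((((WithLp.equiv 2 _) (σE (toDefect DE (pairup hc ha)))).1 : ↥(defectSpace Dsδ)) :
            ↥(defectSpace DC)) = Dsδ (toDefect DC hc) ∧
        ((((WithLp.equiv 2 _) (σE (toDefect DE (pairup hc ha)))).2 : ↥(defectSpace DA)) :
            Hd d H_A) =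
          DA ha - (adjoint (rowOp A)) (((adjoint δ) (toDefect DC hc) : ↥(defectSpace DsA)) : H_A) := by
  set T := rowOp A with hT
  have hDsAs : adjoint DsA = DsA := hDsApos.isSelfAdjoint
  have hint : ∀ x, DsA (T x) = T (DA x) := by
    refine aux_intertwine DsA DA T hDsApos hDApos fun x => ?_
    have h1 : DsA (DsA (T x)) = T x - T (adjoint T (T x)) := DFunLike.congr_fun hDsAsq (T x)
    have h2 : DA (DA x) = x - adjoint T (T x) := DFunLike.congr_fun hDAsq x
    rw [h1, h2, map_sub]
  let δs : ↥(defectSpace DC) →L[ℂ] ↥(defectSpace DsA) := adjoint δ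
  let f1 : (Hd d H_C × Hd d H_A) →ₗ[ℂ] ↥(defectSpace Dsδ) :=
    ((toDefect Dsδ).comp (toDefect DC)).toLinearMap ∘ₗ LinearMap.fst ℂ _ _
  let TS : ↥(defectSpace DsA) →ₗ[ℂ] ↥(defectSpace DA) :=
    LinearMap.codRestrict (defectSpace DA)
      ((adjoint T).comp (defectSpace DsA).subtypeL).toLinearMap
      (fun y => aux_mem_A T DsA DA hDsApos hDApos hint y y.2)
  let f2 : (Hd d H_C × Hd d H_A) →ₗ[ℂ] ↥(defectSpace DA) :=
    (toDefect DA).toLinearMap ∘ₗ LinearMap.snd ℂ _ _ -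
      TS ∘ₗ (δs.comp (toDefect DC)).toLinearMap ∘ₗ LinearMap.fst ℂ _ _
  let e₂ : (Hd d H_C × Hd d H_A) →ₗ[ℂ] WithLp 2 (↥(defectSpace Dsδ) × ↥(defectSpace DA)) :=
    (WithLp.linearEquiv 2 ℂ (↥(defectSpace Dsδ) × ↥(defectSpace DA))).symm.toLinearMap ∘ₗ
      (f1.prod f2)
  let e₁ : (Hd d H_C × Hd d H_A) →ₗ[ℂ] ↥(defectSpace DE) := (toDefect DE).toLinearMap ∘ₗ auxPair
  have hf1 : ∀ p, ((f1 p : ↥(defectSpace Dsδ)) : ↥(defectSpace DC)) = Dsδ (toDefect DC p.1) :=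
    fun _ => rfl
  have hf2 : ∀ p, ((f2 p : ↥(defectSpace DA)) : Hd d H_A) =
      DA p.2 - adjoint T ((δs (toDefect DC p.1) : ↥(defectSpace DsA)) : H_A) := fun _ => rfl
  have he₂ : ∀ p, e₂ p = WithLp.toLp 2 (f1 p, f2 p) := fun _ => rfl
  have hd1 : DenseRange e₁ :=
    (aux_denseRange_toDefect DE).comp auxPair_surj.denseRange (toDefect DE).continuous
  have hd2 : DenseRange e₂ := by
    have : (LinearMap.range e₂).topologicalClosure = ⊤ := by
      rw [Submodule.topologicalClosure_eq_top_iff, Submodule.eq_bot_iff]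
      intro w hw
      rw [Submodule.mem_orthogonal] at hw
      have hw' : ∀ p, inner ℂ (f1 p) w.fst + inner ℂ (f2 p) w.snd = 0 := fun p =>
        hw (e₂ p) ⟨p, rfl⟩
      have hw2 : w.snd = 0 := by
        refine (aux_denseRange_toDefect DA).eq_zero_of_inner_right ℂ ?_
        intro x
        have h1 := hw' (0, x)
        have e1 : f1 (0, x) = 0 := by simp [f1]
        have e2 : f2 (0, x) = toDefect DA x := by simp [f2]
        rw [e1, e2, inner_zero_left, zero_add] at h1
        exact h1
      have hw1 : w.fst = 0 := by
        have hdd : DenseRange ((toDefect Dsδ) ∘ (toDefect DC)) :=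
          (aux_denseRange_toDefect Dsδ).comp (aux_denseRange_toDefect DC)
            (toDefect Dsδ).continuous
        refine hdd.eq_zero_of_inner_right ℂ ?_
        intro x
        have h1 := hw' (x, 0)
        rw [hw2, inner_zero_right, add_zero] at h1
        exact h1
      rw [WithLp.ext_iff]
      exact Prod.ext hw1 hw2
    rw [← Submodule.dense_iff_topologicalClosure_eq_top] at this
    exact this
  have hnorm : ∀ p, ‖e₂ p‖ = ‖e₁ p‖ := by
    rintro ⟨hc, ha⟩
    rw [← sq_eq_sq₀ (norm_nonneg _) (norm_nonneg _)]
    set z := toDefect DC hc with hz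
    set y : H_A := ((δs z : ↥(defectSpace DsA)) : H_A) with hy
    have hBy : B hc = DsA y := by rw [hB]; rfl
    have n1 : ‖e₁ (hc, ha)‖ ^ 2 = ‖DE (pairup hc ha)‖ ^ 2 := rfl
    have n2 : ‖e₂ (hc, ha)‖ ^ 2 = ‖Dsδ z‖ ^ 2 + ‖DA ha - adjoint T y‖ ^ 2 := by
      rw [WithLp.prod_norm_sq_eq_of_L2]; rfl
    have n3 := aux_inner_defect DE hDEpos _ hDEsq (pairup hc ha)
    rw [aux_norm_pairup, aux_rowOp_pairup C A B E hE, WithLp.prod_norm_sq_eq_of_L2] at n3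
    have n4 := aux_inner_defect DC hDCpos _ hDCsq hc
    have n5 := aux_inner_defect DA hDApos T hDAsq ha
    have n6 := aux_inner_defect DsA hDsApos (adjoint T) (by rw [adjoint_adjoint]; exact hDsAsq) y
    have n7 := aux_inner_defect Dsδ hDsδpos (adjoint δ)
      (by rw [adjoint_adjoint]; exact hDsδsq) z
    have n8 : ‖adjoint δ z‖ = ‖y‖ := rfl
    have n9 : ‖z‖ = ‖DC hc‖ := rfl
    have n10 := norm_sub_sq (𝕜 := ℂ) (DA ha) (adjoint T y)
    have n11 := norm_add_sq (𝕜 := ℂ) (DsA y) (T ha)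
    have n12 : inner ℂ (DA ha) (adjoint T y) = inner ℂ (T ha) (DsA y) := by
      rw [adjoint_inner_right, ← hint, ← adjoint_inner_right, hDsAs]
    rw [n12, inner_re_symm] at n10
    rw [n8, n9] at n7
    simp only [hBy] at n3
    rw [n1, n2]
    have n13 : ‖DE (pairup hc ha)‖ ^ 2 =
        ‖hc‖ ^ 2 + ‖ha‖ ^ 2 - (‖rowOp C hc‖ ^ 2 + ‖DsA y + T ha‖ ^ 2) := n3
    linarith
  refine ⟨(LinearEquiv.refl ℂ _).extendOfIsometry e₁ e₂ hd1 hd2 hnorm, fun hc ha => ?_⟩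
  have key := (LinearEquiv.refl ℂ (Hd d H_C × Hd d H_A)).extendOfIsometry_eq e₁ e₂ hd1 hd2 hnorm
    (hc, ha)
  have key' : (LinearEquiv.refl ℂ (Hd d H_C × Hd d H_A)).extendOfIsometry e₁ e₂ hd1 hd2 hnorm
    (toDefect DE (pairup hc ha)) = e₂ (hc, ha) := key
  rw [key']
  exact ⟨rfl, rfl⟩
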